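/- arXiv:2407.03366 — 2 statements merged into one kernel-verified Lean document; each statement's English description precedes it below -/
import Mathlib

section
/- Let n ≥ 2, ρ = (n−1)/2, and let λ be either purely imaginary with nonnegative imaginary part or real with 0 < λ < ρ. For every s ∈ ℝ, the Harish-Chandra spherical function of the hyperbolic space ℍ^n is given by a hypergeometric function: ∫_{S^{n−1}} (cosh s − sinh s · v₁)^{−λ−ρ} dσ(v) = F_λ((1−cosh s)/2), where σ is the normalized (probability) rotation-invariant measure on the unit sphere S^{n−1} ⊂ ℝ^n, v₁ is the first coordinate of v, and the complex power of the positive real number cosh s − sinh s·v₁ uses the principal branch. -/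
open scoped BigOperators
open Filter Topology

noncomputable section

/-- The Lorentzian bilinear form on `ℝ^{1+n}`. -/
def lformR (n : ℕ) (x y : Fin (n+1) → ℝ) : ℝ :=
  ∑ i, (if i = 0 then (-1 : ℝ) else 1) * x i * y i

/-- The complex-bilinear Lorentzian form on `ℂ^{1+n}`. -/
def lformC (n : ℕ) (z w : Fin (n+1) → ℂ) : ℂ :=
  ∑ i, (if i = 0 then (-1 : ℂ) else 1) * z i * w i

/-- The matrix `η = diag(−1,1,…,1)`. -/
def eta (n : ℕ) : Matrix (Fin (n+1)) (Fin (n+1)) ℝ :=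
  Matrix.diagonal (fun i => if i = 0 then (-1 : ℝ) else 1)

/-- Membership in `G = SO(1,n)_e`. -/
def memG (n : ℕ) (g : Matrix (Fin (n+1)) (Fin (n+1)) ℝ) : Prop :=
  g.transpose * eta n * g = eta n ∧ g.det = 1 ∧ 0 < g 0 0

/-- Standard basis vector `e₀`. -/
def e0 (n : ℕ) : Fin (n+1) → ℝ := fun i => if i = 0 then 1 else 0

/-- Standard basis vector `eₙ`. -/
def elast (n : ℕ) : Fin (n+1) → ℝ := fun i => if i = Fin.last n then 1 else 0

/-- Membership in `H = SO(1,n−1)_e`, the stabilizer of `eₙ`. -/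
def memH (n : ℕ) (g : Matrix (Fin (n+1)) (Fin (n+1)) ℝ) : Prop :=
  memG n g ∧ g.mulVec (elast n) = elast n

/-- Membership in `K = SO(n)`, the stabilizer of `e₀`. -/
def memK (n : ℕ) (g : Matrix (Fin (n+1)) (Fin (n+1)) ℝ) : Prop :=
  memG n g ∧ g.mulVec (e0 n) = e0 n

/-- The boost `a_t`. -/
def boost (n : ℕ) (t : ℝ) : Matrix (Fin (n+1)) (Fin (n+1)) ℝ :=
  Matrix.of fun i j =>
    if i = 0 ∧ j = 0 then Real.cosh t
    else if i = Fin.last n ∧ j = Fin.last n then Real.cosh t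
    else if (i = 0 ∧ j = Fin.last n) ∨ (i = Fin.last n ∧ j = 0) then Real.sinh t
    else if i = j then 1 else 0

/-- The upper hemisphere `S^n_+ = {(ix₀, 𝐱) : x₀ > 0, x₀² + |𝐱|² = 1}` in `ℂ^{1+n}`. -/
def Snplus (n : ℕ) : Set (Fin (n+1) → ℂ) :=
  {z | ∃ x : Fin (n+1) → ℝ, 0 < x 0 ∧ (∑ i, (x i)^2) = 1 ∧
    z 0 = Complex.I * (x 0 : ℂ) ∧ ∀ i, i ≠ 0 → z i = (x i : ℂ)}

/-- The crown domain `Ξ = G · S^n_+ ⊂ ℂ^{1+n}`. -/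
def Xi (n : ℕ) : Set (Fin (n+1) → ℂ) :=
  {z | ∃ g w, memG n g ∧ w ∈ Snplus n ∧ z = (g.map (Complex.ofReal)).mulVec w}

/-- The conjugate crown `Ξ̄`. -/
def XiBar (n : ℕ) : Set (Fin (n+1) → ℂ) :=
  {z | (fun i => (starRingEnd ℂ) (z i)) ∈ Xi n}

/-- The de Sitter space `dS^n` viewed inside `ℂ^{1+n}`. -/
def dSC (n : ℕ) : Set (Fin (n+1) → ℂ) :=
  {z | (∀ i, (z i).im = 0) ∧ lformC n z z = 1}

/-- The cut `[1,∞) ⊂ ℂ`. -/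
def slit : Set ℂ := {z | z.im = 0 ∧ 1 ≤ z.re}

/-- Componentwise complex conjugation on `ℂ^{1+n}`. -/
def conjVec (n : ℕ) (z : Fin (n+1) → ℂ) : Fin (n+1) → ℂ :=
  fun i => (starRingEnd ℂ) (z i)

/-- `λ` is admissible: purely imaginary with nonnegative imaginary part, or
real with `0 < λ < ρ = (n−1)/2`. -/
def admissible (n : ℕ) (lam : ℂ) : Prop :=
  (lam.re = 0 ∧ 0 ≤ lam.im) ∨ (lam.im = 0 ∧ 0 < lam.re ∧ lam.re < ((n : ℝ) - 1)/2)

/-- Euler's integral representation of `₂F₁(ρ+λ, ρ−λ; n/2; ·)` on `ℂ∖[1,∞)`,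
with `ρ = (n−1)/2`. -/
def Flam (n : ℕ) (lam : ℂ) (z : ℂ) : ℂ :=
  (Complex.Gamma ((n : ℂ)/2) /
    (Complex.Gamma (((n : ℂ) - 1)/2 - lam) * Complex.Gamma (1/2 + lam))) *
  ∫ t in (0:ℝ)..1, (t : ℂ) ^ (((n : ℂ) - 1)/2 - lam - 1) *
    ((1 : ℂ) - (t : ℂ)) ^ (lam - 1/2) *
    ((1 : ℂ) - z * (t : ℂ)) ^ (-(((n : ℂ) - 1)/2) - lam)

/-- General term of the Gauss hypergeometric series `₂F₁(a,b;c;w)`. -/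
def hypTerm (a b c : ℂ) (w : ℂ) (k : ℕ) : ℂ :=
  (ascPochhammer ℂ k).eval a * (ascPochhammer ℂ k).eval b /
    ((ascPochhammer ℂ k).eval c * (k.factorial : ℂ)) * w ^ k

/-- The curve `z_t = (i cos t, 0, …, 0, sin t)` in the crown `Ξ`. -/
def zCurve (n : ℕ) (t : ℝ) : Fin (n+1) → ℂ :=
  fun i => if i = 0 then Complex.I * (Real.cos t : ℂ)
    else if i = Fin.last n then (Real.sin t : ℂ) else 0

/-- The curve `z̃_t = (−i cos t, 0, …, 0, sin t)` in the conjugate crown `Ξ̄`. -/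
def zCurveBar (n : ℕ) (t : ℝ) : Fin (n+1) → ℂ :=
  fun i => if i = 0 then -Complex.I * (Real.cos t : ℂ)
    else if i = Fin.last n then (Real.sin t : ℂ) else 0

/-- The open future cone `Γ⁺(eₙ)` in `dS^n`. -/
def futureCone (n : ℕ) : Set (Fin (n+1) → ℝ) :=
  {y | lformR n y y = 1 ∧ lformR n (y - elast n) (y - elast n) < 0 ∧ 0 < y 0}

/-- The open past cone `Γ⁻(eₙ)` in `dS^n`. -/
def pastCone (n : ℕ) : Set (Fin (n+1) → ℝ) :=
  {y | lformR n y y = 1 ∧ lformR n (y - elast n) (y - elast n) < 0 ∧ y 0 < 0}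


/-- The boundary value expression in Statement 12 (sign `s = ∓1` for `x ± i0`). -/
def bval (n : ℕ) (lam : ℂ) (x : ℝ) (s : ℝ) : ℂ :=
  (Complex.Gamma ((n : ℂ)/2) * Complex.Gamma ((2 - (n : ℂ))/2) /
      (Complex.Gamma (1/2 + lam) * Complex.Gamma (1/2 - lam))) *
    ∑' k : ℕ, hypTerm (((n : ℂ) - 1)/2 + lam) (((n : ℂ) - 1)/2 - lam) ((n : ℂ)/2)
      ((1 : ℂ) - x) k
  + Complex.exp ((s : ℂ) * (Real.pi : ℂ) * Complex.I * ((2 - (n : ℂ))/2)) *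
      (((x - 1) ^ ((2 - (n : ℝ))/2) : ℝ) : ℂ) *
      (Complex.Gamma ((n : ℂ)/2) * Complex.Gamma (((n : ℂ) - 2)/2) /
        (Complex.Gamma (((n : ℂ) - 1)/2 + lam) * Complex.Gamma (((n : ℂ) - 1)/2 - lam))) *
    ∑' k : ℕ, hypTerm (1/2 - lam) (1/2 + lam) ((4 - (n : ℂ))/2) ((1 : ℂ) - x) k

end

open MeasureTheory in
/-- Differentiation under the integral sign for a jointly continuous family on a compact set. -/
theorem hasDerivAt_integral_mul_of_isCompact {Y : Type*} [TopologicalSpace Y] [MeasurableSpace Y]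
    [OpensMeasurableSpace Y] {K : Set Y} (hK : IsCompact K) (hKm : MeasurableSet K)
    {μ : Measure Y} (hμ : μ Kᶜ = 0) {w : Y → ℂ} (hw : Integrable w μ) {f f' : ℝ → Y → ℂ}
    (hf : ∀ s, ContinuousOn (f s) K)
    (hf' : ContinuousOn (fun q : ℝ × Y => f' q.1 q.2) (Set.univ ×ˢ K))
    (hd : ∀ s, ∀ y ∈ K, HasDerivAt (fun s => f s y) (f' s y) s) (s : ℝ) :
    Integrable (fun y => w y * f' s y) μ ∧
      HasDerivAt (fun s => ∫ y, w y * f s y ∂μ) (∫ y, w y * f' s y ∂μ) s := by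
  have hae : ∀ᵐ y ∂μ, y ∈ K := hμ
  have hrestrict : μ.restrict K = μ := Measure.restrict_eq_self_of_ae_mem hae
  have hmeas : ∀ {g : Y → ℂ}, ContinuousOn g K → AEStronglyMeasurable g μ := fun hg => by
    simpa only [hrestrict] using hg.aestronglyMeasurable (μ := μ) hKm
  have hf'_slice : ContinuousOn (f' s) K :=
    hf'.comp (f := fun y => (s, y)) (by fun_prop) fun y hy => ⟨trivial, hy⟩
  obtain ⟨C, hC⟩ := ((isCompact_Icc (a := s - 1) (b := s + 1)).prod hK).exists_bound_of_continuousOn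
    (hf'.mono (Set.prod_mono (Set.subset_univ _) subset_rfl))
  obtain ⟨D, hD⟩ := hK.exists_bound_of_continuousOn (hf s)
  refine hasDerivAt_integral_of_dominated_loc_of_deriv_le (bound := fun y => ‖w y‖ * C)
    (F' := fun s y => w y * f' s y)
    (Icc_mem_nhds (sub_one_lt s) (lt_add_one s))
    (.of_forall fun x => hw.aestronglyMeasurable.mul (hmeas (hf x))) ?_
    (hw.aestronglyMeasurable.mul (hmeas hf'_slice)) ?_ (hw.norm.mul_const C) ?_
  · exact hw.mul_bdd (hmeas (hf s)) (hae.mono fun y hy => hD y hy)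
  · filter_upwards [hae] with y hy x hx
    rw [norm_mul]
    exact mul_le_mul_of_nonneg_left (hC (x, y) ⟨hx, hy⟩) (norm_nonneg _)
  · filter_upwards [hae] with y hy x _
    exact (hd x y hy).const_mul (w y)

theorem HasDerivAt.ofReal_cpow_const {X : ℝ → ℝ} {X' s : ℝ} (hX : HasDerivAt X X' s)
    (hpos : 0 < X s) (p : ℂ) :
    HasDerivAt (fun s => (X s : ℂ) ^ p) (p * (X s : ℂ) ^ (p - 1) * (X' : ℂ)) s := by
  have h := (hasDerivAt_id (X s : ℂ)).cpow_const (c := p) (Complex.ofReal_mem_slitPlane.2 hpos)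
  simp only [id, mul_one] at h
  exact h.comp s hX.ofReal_comp

theorem ContinuousOn.ofReal_cpow_const {Y : Type*} [TopologicalSpace Y] {X : Y → ℝ} {S : Set Y}
    (hX : ContinuousOn X S) (hpos : ∀ y ∈ S, 0 < X y) (p : ℂ) :
    ContinuousOn (fun y => (X y : ℂ) ^ p) S :=
  (Complex.continuous_ofReal.comp_continuousOn hX).cpow_const
    fun y hy => Complex.ofReal_mem_slitPlane.2 (hpos y hy)

/-- The radial eigenvalue equation `u'' + m coth(s) u' = κ u` has no nonzero solution on `[0, ∞)`
vanishing to first order at the origin. -/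
theorem radial_ode_unique {u u₁ u₂ : ℝ → ℂ} {m : ℝ} (hm : 0 ≤ m) {κ : ℂ}
    (hu : ∀ s, HasDerivAt u (u₁ s) s) (hu₁ : ∀ s, HasDerivAt u₁ (u₂ s) s)
    (h0 : u 0 = 0) (h10 : u₁ 0 = 0)
    (hode : ∀ s, (Real.sinh s : ℂ) * u₂ s + m * Real.cosh s * u₁ s = κ * Real.sinh s * u s)
    {s : ℝ} (hs : 0 ≤ s) : u s = 0 := by
  set C : ℝ := ‖κ + 1‖
  let E : ℝ → ℝ := fun s => ‖u s‖ ^ 2 + ‖u₁ s‖ ^ 2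
  have hE : ∀ s, HasDerivAt E (2 * inner ℝ (u s) (u₁ s) + 2 * inner ℝ (u₁ s) (u₂ s)) s :=
    fun s => (hu s).norm_sq.add (hu₁ s).norm_sq
  have hexp : ∀ s, HasDerivAt (fun s => Real.exp (-C * s)) (Real.exp (-C * s) * (-C)) s := fun s => by
    simpa using ((hasDerivAt_id s).const_mul (-C)).exp
  have hEC := fun s => (hE s).mul (hexp s)
  have hbound : ∀ s, 0 < s →
      2 * inner ℝ (u s) (u₁ s) + 2 * inner ℝ (u₁ s) (u₂ s) ≤ C * E s := by
    intro s hs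
    have hsinh := Real.sinh_pos_iff.2 hs
    have hu₂ : u₂ s = κ * u s - ((m * Real.cosh s / Real.sinh s : ℝ) : ℂ) * u₁ s := by
      have : (Real.sinh s : ℂ) ≠ 0 := by exact_mod_cast hsinh.ne'
      push_cast
      push_cast at this
      field_simp
      have := hode s
      push_cast at this
      linear_combination this
    have hc : 0 ≤ m * Real.cosh s / Real.sinh s :=
      div_nonneg (mul_nonneg hm (Real.cosh_pos s).le) hsinh.le
    have key : inner ℝ (u s) (u₁ s) + inner ℝ (u₁ s) (u₂ s)
        = inner ℝ (u₁ s) ((κ + 1) * u s) - m * Real.cosh s / Real.sinh s * ‖u₁ s‖ ^ 2 := by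
      rw [hu₂, inner_sub_right, ← Complex.real_smul, inner_smul_right, real_inner_self_eq_norm_sq,
        add_mul, one_mul, inner_add_right, real_inner_comm]
      ring
    have hcs : inner ℝ (u₁ s) ((κ + 1) * u s) ≤ ‖u₁ s‖ * (C * ‖u s‖) := by
      simpa only [norm_mul] using real_inner_le_norm (u₁ s) ((κ + 1) * u s)
    have hC : 0 ≤ C := norm_nonneg _
    nlinarith [mul_nonneg hC (sq_nonneg (‖u s‖ - ‖u₁ s‖)), mul_nonneg hc (sq_nonneg ‖u₁ s‖)]
  have hanti : AntitoneOn (fun s => E s * Real.exp (-C * s)) (Set.Ici 0) := by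
    refine antitoneOn_of_deriv_nonpos (convex_Ici 0)
      (fun s _ => (hEC s).continuousAt.continuousWithinAt)
      (fun s _ => (hEC s).differentiableAt.differentiableWithinAt) fun s hs => ?_
    rw [interior_Ici] at hs
    refine (HasDerivAt.deriv (hEC s)).trans_le ?_
    nlinarith [hbound s hs, Real.exp_pos (-C * s)]
  have hle := hanti Set.self_mem_Ici hs hs
  have hE0 : E 0 = 0 := by simp [E, h0, h10]
  simp only [hE0, zero_mul] at hle
  have hEs : E s ≤ 0 := by
    by_contra! h
    exact (mul_pos h (Real.exp_pos (-C * s))).not_ge hle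
  have : ‖u s‖ ^ 2 = 0 := le_antisymm (by nlinarith [sq_nonneg ‖u₁ s‖]) (sq_nonneg _)
  simpa using this

/-- A reflection in the plane of two distinct coordinates, with prescribed angle. -/
theorem exists_linearIsometryEquiv_coord {ι : Type*} [Fintype ι] [DecidableEq ι] {i j : ι}
    (hij : i ≠ j) (θ : ℝ) :
    ∃ f : EuclideanSpace ℝ ι ≃ₗᵢ[ℝ] EuclideanSpace ℝ ι, ∀ v,
      f v i = Real.cos (2 * θ) * v i + Real.sin (2 * θ) * v j ∧
      f v j = Real.sin (2 * θ) * v i - Real.cos (2 * θ) * v j := by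
  let u : EuclideanSpace ℝ ι :=
    Real.cos θ • EuclideanSpace.single i 1 + Real.sin θ • EuclideanSpace.single j 1
  have hinner : ∀ v, inner ℝ u v = Real.cos θ * v i + Real.sin θ * v j := fun v => by
    simp [u, inner_add_left, inner_smul_left, EuclideanSpace.inner_single_left]
  have hi : u i = Real.cos θ := by simp [u, hij]
  have hj : u j = Real.sin θ := by simp [u, hij.symm]
  have hu : ‖u‖ ^ 2 = 1 := by
    rw [← real_inner_self_eq_norm_sq, hinner, hi, hj]
    nlinarith [Real.sin_sq_add_cos_sq θ]
  refine ⟨(Submodule.span ℝ {u}).reflection, fun v => ?_⟩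
  rw [Submodule.reflection_singleton_apply, hinner]
  simp only [RCLike.ofReal_real_eq_id, id, hu, div_one, PiLp.sub_apply, PiLp.smul_apply, hi, hj,
    smul_eq_mul, nsmul_eq_mul, Nat.cast_ofNat, Real.cos_two_mul, Real.sin_two_mul]
  constructor
  · ring
  · linear_combination 2 * v j * Real.sin_sq_add_cos_sq θ

theorem cpow_sub_one_mul {x : ℂ} (hx : x ≠ 0) (p : ℂ) : x ^ (p - 1) * x = x ^ p := by
  nth_rw 2 [← Complex.cpow_one x]
  rw [← Complex.cpow_add _ _ hx, sub_add_cancel]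

theorem cpow_sub_two_mul {x : ℂ} (hx : x ≠ 0) (p : ℂ) : x ^ (p - 2) * x = x ^ (p - 1) := by
  rw [← cpow_sub_one_mul hx (p - 1), sub_sub, one_add_one_eq_two]

theorem cpow_sub_two_mul_sq {x : ℂ} (hx : x ≠ 0) (p : ℂ) : x ^ (p - 2) * x ^ 2 = x ^ p := by
  rw [sq, ← mul_assoc, cpow_sub_two_mul hx, cpow_sub_one_mul hx]

/-- `u` is the solution of `u'' + m coth(s) u' = κ u` with `u 0 = 1` and `u' 0 = 0`. -/
def IsRadialEigenfunction (m : ℝ) (κ : ℂ) (u : ℝ → ℂ) : Prop :=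
  u 0 = 1 ∧ ∃ u₁ u₂ : ℝ → ℂ, u₁ 0 = 0 ∧ (∀ s, HasDerivAt u (u₁ s) s) ∧
    (∀ s, HasDerivAt u₁ (u₂ s) s) ∧
    ∀ s, (Real.sinh s : ℂ) * u₂ s + m * Real.cosh s * u₁ s = κ * Real.sinh s * u s

theorem IsRadialEigenfunction.eq {m : ℝ} (hm : 0 ≤ m) {κ : ℂ} {u v : ℝ → ℂ}
    (hu : IsRadialEigenfunction m κ u) (hv : IsRadialEigenfunction m κ v) {s : ℝ} (hs : 0 ≤ s) :
    u s = v s := by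
  obtain ⟨hu0, u₁, u₂, hu10, hu, hu₁, hou⟩ := hu
  obtain ⟨hv0, v₁, v₂, hv10, hv, hv₁, hov⟩ := hv
  refine sub_eq_zero.1 (radial_ode_unique (u := u - v) (u₁ := u₁ - v₁) (u₂ := u₂ - v₂) hm
    (fun s => (hu s).sub (hv s)) (fun s => (hu₁ s).sub (hv₁ s)) (by simp [hu0, hv0])
    (by simp [hu10, hv10]) (κ := κ) (fun s => ?_) hs)
  simp only [Pi.sub_apply]
  linear_combination hou s - hov s

open MeasureTheory in
/-- An average of complex powers `X ^ p` is a radial eigenfunction as soon as the eigenvalue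
equation holds under the integral sign. -/
theorem isRadialEigenfunction_integral {Y : Type*} [TopologicalSpace Y] [MeasurableSpace Y]
    [OpensMeasurableSpace Y] {K : Set Y} (hK : IsCompact K) (hKm : MeasurableSet K)
    {μ : Measure Y} (hμ : μ Kᶜ = 0) {w : Y → ℂ} (hw : Integrable w μ) {m : ℝ} {κ p : ℂ}
    {X X₁ X₂ : ℝ → Y → ℝ} (hX : Continuous fun q : ℝ × Y => X q.1 q.2)
    (hX₁ : Continuous fun q : ℝ × Y => X₁ q.1 q.2) (hX₂ : Continuous fun q : ℝ × Y => X₂ q.1 q.2)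
    (hd : ∀ s y, HasDerivAt (fun s => X s y) (X₁ s y) s)
    (hd₁ : ∀ s y, HasDerivAt (fun s => X₁ s y) (X₂ s y) s) (hpos : ∀ s, ∀ y ∈ K, 0 < X s y)
    (hX0 : ∀ y, X 0 y = 1) (hw1 : ∫ y, w y ∂μ = 1) (hX10 : ∫ y, w y * X₁ 0 y ∂μ = 0)
    (hode : ∀ s, ∫ y, w y * (Real.sinh s * (p * (p - 1) * (X s y : ℂ) ^ (p - 2) * X₁ s y ^ 2 +
        p * (X s y : ℂ) ^ (p - 1) * X₂ s y) +
      m * Real.cosh s * (p * (X s y : ℂ) ^ (p - 1) * X₁ s y) -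
      κ * Real.sinh s * (X s y : ℂ) ^ p) ∂μ = 0) :
    IsRadialEigenfunction m κ fun s => ∫ y, w y * (X s y : ℂ) ^ p ∂μ := by
  have hcpow : ∀ r : ℂ, ContinuousOn (fun q : ℝ × Y => (X q.1 q.2 : ℂ) ^ r) (Set.univ ×ˢ K) :=
    fun r => hX.continuousOn.ofReal_cpow_const (fun q hq => hpos q.1 q.2 hq.2) r
  have hslice : ∀ {g : ℝ → Y → ℂ}, ContinuousOn (fun q : ℝ × Y => g q.1 q.2) (Set.univ ×ˢ K) →
      ∀ s, ContinuousOn (g s) K := fun hg s =>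
    hg.comp (f := fun y => (s, y)) (by fun_prop) fun y hy => ⟨trivial, hy⟩
  have hc₁ : ContinuousOn (fun q : ℝ × Y => p * (X q.1 q.2 : ℂ) ^ (p - 1) * (X₁ q.1 q.2 : ℂ))
      (Set.univ ×ˢ K) :=
    (continuousOn_const.mul (hcpow _)).mul (Complex.continuous_ofReal.comp hX₁).continuousOn
  have hc₂ : ContinuousOn (fun q : ℝ × Y => p * (p - 1) * (X q.1 q.2 : ℂ) ^ (p - 2) *
      (X₁ q.1 q.2 : ℂ) ^ 2 + p * (X q.1 q.2 : ℂ) ^ (p - 1) * (X₂ q.1 q.2 : ℂ)) (Set.univ ×ˢ K) :=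
    ((continuousOn_const.mul (hcpow _)).mul
      ((Complex.continuous_ofReal.comp hX₁).pow 2).continuousOn).add
    ((continuousOn_const.mul (hcpow _)).mul (Complex.continuous_ofReal.comp hX₂).continuousOn)
  have H₁ := hasDerivAt_integral_mul_of_isCompact hK hKm hμ hw
    (f := fun s y => (X s y : ℂ) ^ p) (f' := fun s y => p * (X s y : ℂ) ^ (p - 1) * (X₁ s y : ℂ))
    (hslice (g := fun s y => (X s y : ℂ) ^ p) (hcpow p)) hc₁ fun s y hy => (hd s y).ofReal_cpow_const (hpos s y hy) p
  have H₂ := hasDerivAt_integral_mul_of_isCompact hK hKm hμ hw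
    (f := fun s y => p * (X s y : ℂ) ^ (p - 1) * (X₁ s y : ℂ))
    (f' := fun s y => p * (p - 1) * (X s y : ℂ) ^ (p - 2) * (X₁ s y : ℂ) ^ 2 +
      p * (X s y : ℂ) ^ (p - 1) * (X₂ s y : ℂ)) (hslice hc₁) hc₂ fun s y hy => by
    refine ((((hd s y).ofReal_cpow_const (hpos s y hy) (p - 1)).const_mul p).mul
      (hd₁ s y).ofReal_comp).congr_deriv ?_
    rw [show p - 1 - 1 = p - 2 by ring]
    ring
  refine ⟨by simp [hX0, hw1], _, _, ?_, fun s => (H₁ s).2, fun s => (H₂ s).2, fun s => ?_⟩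
  · simp only [hX0, Complex.ofReal_one, Complex.one_cpow, mul_one, mul_left_comm _ p,
      integral_const_mul, hX10, mul_zero]
  · have hae : ∀ᵐ y ∂μ, y ∈ K := hμ
    have hint : Integrable (fun y => w y * (X s y : ℂ) ^ p) μ := by
      obtain ⟨D, hD⟩ := hK.exists_bound_of_continuousOn (hslice (g := fun s y => (X s y : ℂ) ^ p) (hcpow p) s)
      have hmeas := (hslice (g := fun s y => (X s y : ℂ) ^ p) (hcpow p) s).aestronglyMeasurable (μ := μ) hKm
      rw [Measure.restrict_eq_self_of_ae_mem hae] at hmeas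
      exact hw.mul_bdd hmeas (hae.mono fun y hy => hD y hy)
    have hadd := integral_add ((H₂ s).1.const_mul (Real.sinh s : ℂ))
      ((H₁ s).1.const_mul (m * Real.cosh s : ℂ))
    have hsub := integral_sub (((H₂ s).1.const_mul (Real.sinh s : ℂ)).add
      ((H₁ s).1.const_mul (m * Real.cosh s : ℂ))) (hint.const_mul (κ * Real.sinh s : ℂ))
    simp only [Pi.add_apply] at hsub
    rw [← sub_eq_zero, ← hode s, ← integral_const_mul, ← integral_const_mul, ← integral_const_mul,
      ← hadd, ← hsub]
    refine integral_congr_ae (.of_forall fun y => ?_)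
    simp only
    ring

section Sphere

open MeasureTheory

variable {n : ℕ} {σ : Measure (EuclideanSpace ℝ (Fin n))}

theorem integral_comp_isometry
    (hinv : ∀ f : EuclideanSpace ℝ (Fin n) ≃ₗᵢ[ℝ] EuclideanSpace ℝ (Fin n), σ.map f = σ)
    (f : EuclideanSpace ℝ (Fin n) ≃ₗᵢ[ℝ] EuclideanSpace ℝ (Fin n))
    (g : EuclideanSpace ℝ (Fin n) → ℂ) : ∫ v, g (f v) ∂σ = ∫ v, g v ∂σ := by
  conv_rhs => rw [← hinv f]
  exact (integral_map_equiv f.toHomeomorph.toMeasurableEquiv g).symm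

theorem coord_mem_Icc_of_mem_sphere {v : EuclideanSpace ℝ (Fin n)}
    (hv : v ∈ Metric.sphere (0 : EuclideanSpace ℝ (Fin n)) 1) (i : Fin n) :
    v i ∈ Set.Icc (-1 : ℝ) 1 := by
  rw [mem_sphere_zero_iff_norm] at hv
  exact abs_le.1 (hv ▸ PiLp.norm_apply_le v i)

/-- Infinitesimal rotation invariance in the plane of the coordinates `i` and `j`. -/
theorem integral_sphere_coord_pair [IsProbabilityMeasure σ]
    (hsupp : σ (Metric.sphere (0 : EuclideanSpace ℝ (Fin n)) 1)ᶜ = 0)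
    (hinv : ∀ f : EuclideanSpace ℝ (Fin n) ≃ₗᵢ[ℝ] EuclideanSpace ℝ (Fin n), σ.map f = σ)
    {i j : Fin n} (hij : i ≠ j) {h h' : ℝ → ℂ}
    (hh : ∀ x ∈ Set.Icc (-1 : ℝ) 1, HasDerivAt h (h' x) x)
    (hh' : ContinuousOn h' (Set.Icc (-1) 1)) :
    Integrable (fun v => (v j : ℂ) ^ 2 * h' (v i) - v i * h (v i)) σ ∧
      ∫ v, ((v j : ℂ) ^ 2 * h' (v i) - v i * h (v i)) ∂σ = 0 := by
  choose F hF using exists_linearIsometryEquiv_coord hij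
  set K := Metric.sphere (0 : EuclideanSpace ℝ (Fin n)) 1
  have hFK : ∀ θ, ∀ v ∈ K, Real.cos (2 * θ) * v i + Real.sin (2 * θ) * v j ∈ Set.Icc (-1 : ℝ) 1 := by
    intro θ v hv
    rw [← (hF θ v).1]
    refine coord_mem_Icc_of_mem_sphere ?_ i
    rw [mem_sphere_zero_iff_norm, LinearIsometryEquiv.norm_map]
    exact mem_sphere_zero_iff_norm.1 hv
  have hcont : ContinuousOn h (Set.Icc (-1) 1) := fun x hx =>
    (hh x hx).continuousAt.continuousWithinAt
  have hcoord : Continuous fun q : ℝ × EuclideanSpace ℝ (Fin n) =>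
      Real.cos (2 * q.1) * q.2 i + Real.sin (2 * q.1) * q.2 j := by fun_prop
  have hmaps : Set.MapsTo (fun q : ℝ × EuclideanSpace ℝ (Fin n) =>
      Real.cos (2 * q.1) * q.2 i + Real.sin (2 * q.1) * q.2 j) (Set.univ ×ˢ K) (Set.Icc (-1) 1) :=
    fun q hq => hFK q.1 q.2 hq.2
  obtain ⟨hint, hder⟩ := hasDerivAt_integral_mul_of_isCompact (isCompact_sphere _ _)
    Metric.isClosed_sphere.measurableSet hsupp (integrable_const (1 : ℂ))
    (f := fun θ v => ((Real.sin (2 * θ) * v i - Real.cos (2 * θ) * v j : ℝ) : ℂ) *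
      h (Real.cos (2 * θ) * v i + Real.sin (2 * θ) * v j))
    (f' := fun θ v => ((2 * (Real.cos (2 * θ) * v i + Real.sin (2 * θ) * v j) : ℝ) : ℂ) *
        h (Real.cos (2 * θ) * v i + Real.sin (2 * θ) * v j) -
      ((2 * (Real.sin (2 * θ) * v i - Real.cos (2 * θ) * v j) ^ 2 : ℝ) : ℂ) *
        h' (Real.cos (2 * θ) * v i + Real.sin (2 * θ) * v j))
    (fun θ => .mul (Continuous.continuousOn (by fun_prop))
      (hcont.comp (by fun_prop) (hFK θ)))
    (.sub (.mul (Continuous.continuousOn (by fun_prop)) (hcont.comp hcoord.continuousOn hmaps))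
      (.mul (Continuous.continuousOn (by fun_prop)) (hh'.comp hcoord.continuousOn hmaps)))
    (fun θ v hv => by
      have h2 : HasDerivAt (fun θ : ℝ => 2 * θ) 2 θ := by
        simpa using (hasDerivAt_id θ).const_mul 2
      have hA := (h2.sin.mul_const (v i)).sub (h2.cos.mul_const (v j))
      have hB := (h2.cos.mul_const (v i)).add (h2.sin.mul_const (v j))
      have hC := (hh _ (hFK θ v hv)).scomp θ hB
      refine (hA.ofReal_comp.mul hC).congr_deriv ?_
      simp only [Complex.real_smul, Function.comp, Pi.add_apply, Pi.sub_apply]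
      push_cast
      ring) 0
  have hconst : ∀ θ, ∫ v, (1 : ℂ) * (((Real.sin (2 * θ) * v i - Real.cos (2 * θ) * v j : ℝ) : ℂ) *
      h (Real.cos (2 * θ) * v i + Real.sin (2 * θ) * v j)) ∂σ = ∫ v, (v j : ℂ) * h (v i) ∂σ := by
    intro θ
    rw [← integral_comp_isometry hinv (F θ) fun v => (v j : ℂ) * h (v i)]
    simp only [(hF θ _).1, (hF θ _).2, one_mul]
  simp only [hconst] at hder
  have hzero := hder.unique (hasDerivAt_const _ _)
  have heq : (fun v : EuclideanSpace ℝ (Fin n) => (v j : ℂ) ^ 2 * h' (v i) - v i * h (v i)) =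
      fun v => (-1 / 2 : ℂ) * ((1 : ℂ) *
      (((2 * (Real.cos (2 * 0) * v i + Real.sin (2 * 0) * v j) : ℝ) : ℂ) *
        h (Real.cos (2 * 0) * v i + Real.sin (2 * 0) * v j) -
      ((2 * (Real.sin (2 * 0) * v i - Real.cos (2 * 0) * v j) ^ 2 : ℝ) : ℂ) *
        h' (Real.cos (2 * 0) * v i + Real.sin (2 * 0) * v j))) := by
    funext v
    simp only [mul_zero, Real.cos_zero, Real.sin_zero, one_mul, zero_mul, add_zero, zero_sub]
    push_cast
    ring
  rw [heq]
  exact ⟨hint.const_mul _, by rw [integral_const_mul, hzero, mul_zero]⟩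

/-- Integration by parts for zonal functions on the sphere. -/
theorem integral_sphere_zonal [IsProbabilityMeasure σ]
    (hsupp : σ (Metric.sphere (0 : EuclideanSpace ℝ (Fin n)) 1)ᶜ = 0)
    (hinv : ∀ f : EuclideanSpace ℝ (Fin n) ≃ₗᵢ[ℝ] EuclideanSpace ℝ (Fin n), σ.map f = σ)
    (i : Fin n) {h h' : ℝ → ℂ} (hh : ∀ x ∈ Set.Icc (-1 : ℝ) 1, HasDerivAt h (h' x) x)
    (hh' : ContinuousOn h' (Set.Icc (-1) 1)) :
    ∫ v, ((1 - (v i : ℂ) ^ 2) * h' (v i) - (n - 1) * v i * h (v i)) ∂σ = 0 := by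
  have hpair := fun j (hj : j ∈ Finset.univ.erase i) =>
    integral_sphere_coord_pair hsupp hinv (Finset.ne_of_mem_erase hj).symm hh hh'
  rw [← Finset.sum_eq_zero fun j hj => (hpair j hj).2, ← integral_finsetSum _ fun j hj => (hpair j hj).1]
  have hae : ∀ᵐ v ∂σ, v ∈ Metric.sphere (0 : EuclideanSpace ℝ (Fin n)) 1 := hsupp
  refine integral_congr_ae (hae.mono fun v hv => ?_)
  have hsum : ∑ j, v j ^ 2 = 1 := by
    simpa [mem_sphere_zero_iff_norm.1 hv] using (EuclideanSpace.norm_sq_eq v).symm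
  rw [← Finset.add_sum_erase _ _ (Finset.mem_univ i)] at hsum
  have hsum' : (v i : ℂ) ^ 2 + ∑ j ∈ Finset.univ.erase i, (v j : ℂ) ^ 2 = 1 := by
    exact_mod_cast hsum
  have hn : 1 ≤ n := i.pos
  simp only [Finset.sum_sub_distrib, ← Finset.sum_mul, Finset.sum_const, nsmul_eq_mul,
    Finset.card_erase_of_mem (Finset.mem_univ i), Finset.card_univ, Fintype.card_fin]
  push_cast [Nat.cast_sub hn]
  linear_combination h' (v i) * -hsum'

theorem cosh_sub_sinh_mul_pos (s : ℝ) {x : ℝ} (hx : x ∈ Set.Icc (-1 : ℝ) 1) :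
    0 < Real.cosh s - Real.sinh s * x := by
  have h : |Real.sinh s * x| ≤ |Real.sinh s| := by
    rw [abs_mul]
    exact mul_le_of_le_one_right (abs_nonneg _) (abs_le.2 hx)
  have h' : |Real.sinh s| < Real.cosh s := abs_lt_of_sq_lt_sq
    (by linarith [Real.cosh_sq s]) (Real.cosh_pos s).le
  linarith [le_abs_self (Real.sinh s * x)]

theorem isRadialEigenfunction_sphere_average [IsProbabilityMeasure σ]
    (hsupp : σ (Metric.sphere (0 : EuclideanSpace ℝ (Fin n)) 1)ᶜ = 0)
    (hinv : ∀ f : EuclideanSpace ℝ (Fin n) ≃ₗᵢ[ℝ] EuclideanSpace ℝ (Fin n), σ.map f = σ)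
    (i : Fin n) (p : ℂ) :
    IsRadialEigenfunction (n - 1) (p * (p + (n - 1)))
      fun s => ∫ v, ((Real.cosh s - Real.sinh s * v i : ℝ) : ℂ) ^ p ∂σ := by
  have hae : ∀ᵐ v ∂σ, v ∈ Metric.sphere (0 : EuclideanSpace ℝ (Fin n)) 1 := hsupp
  have key := isRadialEigenfunction_integral (isCompact_sphere _ _)
    Metric.isClosed_sphere.measurableSet hsupp (integrable_const (1 : ℂ))
    (m := n - 1) (κ := p * (p + (n - 1))) (p := p)
    (X := fun s v => Real.cosh s - Real.sinh s * v i)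
    (X₁ := fun s v => Real.sinh s - Real.cosh s * v i)
    (X₂ := fun s v => Real.cosh s - Real.sinh s * v i)
    (by fun_prop) (by fun_prop) (by fun_prop)
    (fun s v => (Real.hasDerivAt_cosh s).sub ((Real.hasDerivAt_sinh s).mul_const _))
    (fun s v => (Real.hasDerivAt_sinh s).sub ((Real.hasDerivAt_cosh s).mul_const _))
    (fun s v hv => cosh_sub_sinh_mul_pos s (coord_mem_Icc_of_mem_sphere hv i))
    (by simp) (by simp) ?_ ?_
  · simpa only [one_mul] using key
  · have hneg := integral_comp_isometry hinv (LinearIsometryEquiv.neg ℝ) fun v => (v i : ℂ)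
    simp only [LinearIsometryEquiv.coe_neg, PiLp.neg_apply, Complex.ofReal_neg,
      integral_neg] at hneg
    have : ∫ v, (v i : ℂ) ∂σ = 0 := self_eq_neg.1 hneg.symm
    simp [integral_neg, this]
  · intro s
    have hzonal := integral_sphere_zonal hsupp hinv i
      (h := fun x => ((Real.cosh s - Real.sinh s * x : ℝ) : ℂ) ^ (p - 1))
      (h' := fun x => (p - 1) * ((Real.cosh s - Real.sinh s * x : ℝ) : ℂ) ^ (p - 1 - 1) *
        ((-(Real.sinh s * 1) : ℝ) : ℂ))
      (fun x hx => HasDerivAt.ofReal_cpow_const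
        (((hasDerivAt_id x).const_mul (Real.sinh s)).const_sub (Real.cosh s))
        (cosh_sub_sinh_mul_pos s hx) _)
      ((continuousOn_const.mul (ContinuousOn.ofReal_cpow_const (by fun_prop)
        (fun x hx => cosh_sub_sinh_mul_pos s hx) _)).mul continuousOn_const)
    rw [← mul_zero p, ← hzonal, ← integral_const_mul]
    refine integral_congr_ae (hae.mono fun v hv => ?_)
    have hX := cosh_sub_sinh_mul_pos s (coord_mem_Icc_of_mem_sphere hv i)
    have hne : ((Real.cosh s - Real.sinh s * v i : ℝ) : ℂ) ≠ 0 := by exact_mod_cast hX.ne'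
    simp only [sub_sub, one_add_one_eq_two]
    rw [← cpow_sub_two_mul hne p, ← cpow_sub_two_mul_sq hne p]
    have hcs : (Real.cosh s : ℂ) ^ 2 = Real.sinh s ^ 2 + 1 := by exact_mod_cast Real.cosh_sq s
    push_cast at hcs ⊢
    generalize (_ : ℂ) ^ (p - 2) = Y
    linear_combination -p * Y * ((p - 1) * Complex.sinh s * (1 - (v i : ℂ) ^ 2) +
      (n - 1) * (Complex.cosh s - Complex.sinh s * v i) * v i) * hcs

end Sphere

section Euler

open MeasureTheory

theorem one_add_mul_cosh_pos (s : ℝ) {t : ℝ} (ht : 0 ≤ t) :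
    0 < 1 + t * ((Real.cosh s - 1) / 2) := by
  nlinarith [Real.one_le_cosh s, mul_nonneg ht (sub_nonneg.2 (Real.one_le_cosh s))]

/-- The hypergeometric operator applied to the Euler integrand is an exact derivative. -/
theorem hasDerivAt_euler_primitive {m : ℝ} {b d p : ℂ} (hbp : b = m + p)
    (hbd : b + d = (m + 1) / 2) (s : ℝ) {t : ℝ} (ht : t ∈ Set.Ioo (0 : ℝ) 1) :
    HasDerivAt (fun t : ℝ => -p * Real.sinh s * ((t : ℂ) ^ b * ((1 - t : ℝ) : ℂ) ^ d *
        ((1 + t * ((Real.cosh s - 1) / 2) : ℝ) : ℂ) ^ (p - 1)))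
      ((t : ℂ) ^ (b - 1) * (1 - (t : ℂ)) ^ (d - 1) *
        (Real.sinh s * (p * (p - 1) * ((1 + t * ((Real.cosh s - 1) / 2) : ℝ) : ℂ) ^ (p - 2) *
            ((t * (Real.sinh s / 2) : ℝ) : ℂ) ^ 2 +
          p * ((1 + t * ((Real.cosh s - 1) / 2) : ℝ) : ℂ) ^ (p - 1) *
            ((t * (Real.cosh s / 2) : ℝ) : ℂ)) +
        m * Real.cosh s * (p * ((1 + t * ((Real.cosh s - 1) / 2) : ℝ) : ℂ) ^ (p - 1) *
          ((t * (Real.sinh s / 2) : ℝ) : ℂ)) -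
        p * (p + m) * Real.sinh s * ((1 + t * ((Real.cosh s - 1) / 2) : ℝ) : ℂ) ^ p)) t := by
  have hQ := one_add_mul_cosh_pos s ht.1.le
  have h1t : 0 < 1 - t := sub_pos.2 ht.2
  have hA := HasDerivAt.ofReal_cpow_const (hasDerivAt_id t) ht.1 b
  have hB := HasDerivAt.ofReal_cpow_const ((hasDerivAt_id t).const_sub 1) h1t d
  have hC := HasDerivAt.ofReal_cpow_const
    (((hasDerivAt_id t).mul_const ((Real.cosh s - 1) / 2)).const_add 1) hQ (p - 1)
  refine (((hA.mul hB).mul hC).const_mul (-p * Real.sinh s : ℂ)).congr_deriv ?_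
  have hne : ∀ {x : ℝ}, 0 < x → (x : ℂ) ≠ 0 := fun hx => by exact_mod_cast hx.ne'
  have hcs : (Real.cosh s : ℂ) ^ 2 = Real.sinh s ^ 2 + 1 := by exact_mod_cast Real.cosh_sq s
  have hd : d = (m + 1) / 2 - (m + p) := by linear_combination hbd - hbp
  simp only [Pi.mul_apply, id, sub_sub p 1 1, one_add_one_eq_two]
  rw [← cpow_sub_two_mul (hne hQ), ← cpow_sub_two_mul_sq (hne hQ) p, ← cpow_sub_one_mul (hne ht.1) b,
    ← cpow_sub_one_mul (hne h1t) d]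
  push_cast at hcs ⊢
  generalize (_ : ℂ) ^ (p - 2) = Y, (_ : ℂ) ^ (b - 1) = T, (_ : ℂ) ^ (d - 1) = S
  rw [hd, hbp]
  linear_combination T * S * Y * Complex.sinh s * p * (p - 1) * t ^ 2 / 4 * hcs

theorem isRadialEigenfunction_euler {m : ℝ} {b d p : ℂ} (hbp : b = m + p)
    (hbd : b + d = (m + 1) / 2) (hb : 0 < b.re) (hd : 0 < d.re) :
    IsRadialEigenfunction m (p * (p + m)) fun s =>
      Complex.Gamma (b + d) / (Complex.Gamma b * Complex.Gamma d) *
      ∫ t in (0 : ℝ)..1, (t : ℂ) ^ (b - 1) * (1 - (t : ℂ)) ^ (d - 1) *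
        ((1 + t * ((Real.cosh s - 1) / 2) : ℝ) : ℂ) ^ p := by
  have hconv := Complex.betaIntegral_convergent hb hd
  set C := Complex.Gamma (b + d) / (Complex.Gamma b * Complex.Gamma d)
  have hw := (intervalIntegrable_iff_integrableOn_Ioc_of_le zero_le_one).1 hconv
  have hsupp : (volume.restrict (Set.Ioc (0 : ℝ) 1)) (Set.Icc 0 1)ᶜ = 0 := by
    rw [Measure.restrict_apply measurableSet_Icc.compl]
    convert measure_empty (μ := (volume : Measure ℝ))
    exact Set.disjoint_iff_inter_eq_empty.1
      (Set.disjoint_compl_left_iff_subset.2 Set.Ioc_subset_Icc_self)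
  have key := isRadialEigenfunction_integral isCompact_Icc measurableSet_Icc hsupp
    (hw.const_mul C) (m := m) (κ := p * (p + m)) (p := p)
    (X := fun s t => 1 + t * ((Real.cosh s - 1) / 2))
    (X₁ := fun s t => t * (Real.sinh s / 2)) (X₂ := fun s t => t * (Real.cosh s / 2))
    (by fun_prop) (by fun_prop) (by fun_prop)
    (fun s t => ((((Real.hasDerivAt_cosh s).sub_const 1).div_const 2).const_mul t).const_add 1)
    (fun s t => ((Real.hasDerivAt_sinh s).div_const 2).const_mul t)
    (fun s t ht => one_add_mul_cosh_pos s ht.1) (by simp) ?_ (by simp) ?_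
  · simpa only [intervalIntegral.integral_of_le zero_le_one, mul_assoc, integral_const_mul]
      using key
  · rw [integral_const_mul, ← intervalIntegral.integral_of_le zero_le_one]
    change C * Complex.betaIntegral b d = 1
    have hbeta := Complex.Gamma_mul_Gamma_eq_betaIntegral hb hd
    rw [div_mul_eq_mul_div, ← hbeta, div_self]
    exact mul_ne_zero (Complex.Gamma_ne_zero_of_re_pos hb) (Complex.Gamma_ne_zero_of_re_pos hd)
  · intro s
    simp only [mul_assoc C]
    rw [integral_const_mul, ← intervalIntegral.integral_of_le zero_le_one,
      intervalIntegral.integral_eq_sub_of_hasDerivAt_of_le zero_le_one ?_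
        (fun t ht => hasDerivAt_euler_primitive hbp hbd s ht) ?_]
    · have hb0 : b ≠ 0 := fun h => by simp [h] at hb
      have hd0 : d ≠ 0 := fun h => by simp [h] at hd
      simp [hb0, hd0]
    · refine continuousOn_const.mul (ContinuousOn.mul (Continuous.continuousOn ?_) ?_)
      · exact (Complex.continuous_ofReal_cpow_const hb).mul
          ((Complex.continuous_ofReal_cpow_const hd).comp (by fun_prop))
      · exact ContinuousOn.ofReal_cpow_const (by fun_prop)
          (fun t ht => one_add_mul_cosh_pos s ht.1) _
    · have hcpow : ∀ r : ℂ, ContinuousOn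
          (fun t : ℝ => ((1 + t * ((Real.cosh s - 1) / 2) : ℝ) : ℂ) ^ r) (Set.uIcc 0 1) := fun r =>
        ContinuousOn.ofReal_cpow_const (by fun_prop) (fun t ht => by
          rw [Set.uIcc_of_le zero_le_one] at ht
          exact one_add_mul_cosh_pos s ht.1) r
      refine hconv.mul_continuousOn ?_
      have h0 := hcpow p
      have h1 := hcpow (p - 1)
      have h2 := hcpow (p - 2)
      fun_prop

end Euler

theorem stmt8 (n : ℕ) (hn : 2 ≤ n) (lam : ℂ) (hlam : admissible n lam)
    (σ : MeasureTheory.Measure (EuclideanSpace ℝ (Fin n)))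
    [MeasureTheory.IsProbabilityMeasure σ]
    (hsupp : σ (Metric.sphere (0 : EuclideanSpace ℝ (Fin n)) 1)ᶜ = 0)
    (hinv : ∀ f : EuclideanSpace ℝ (Fin n) ≃ₗᵢ[ℝ] EuclideanSpace ℝ (Fin n),
      σ.map f = σ)
    (s : ℝ) :
    ∫ v, ((Real.cosh s - Real.sinh s * v ⟨0, by omega⟩ : ℝ) : ℂ) ^
        (-lam - ((n : ℂ) - 1)/2) ∂σ
      = Flam n lam ((1 - Real.cosh s)/2) := by
  have hn1 : (0 : ℝ) ≤ (n : ℝ) - 1 := by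
    have : (2 : ℝ) ≤ n := by exact_mod_cast hn
    linarith
  have hre : 0 ≤ lam.re ∧ lam.re < ((n : ℝ) - 1) / 2 := by
    have : (2 : ℝ) ≤ n := by exact_mod_cast hn
    rcases hlam with ⟨h, -⟩ | ⟨-, h, h'⟩
    · rw [h]
      exact ⟨le_rfl, by linarith⟩
    · exact ⟨h.le, h'⟩
  have hcast : ((n : ℂ) - 1) / 2 = ((((n : ℝ) - 1) / 2 : ℝ) : ℂ) := by push_cast; rfl
  have hb : 0 < (((n : ℂ) - 1) / 2 - lam).re := by
    rw [hcast, Complex.sub_re, Complex.ofReal_re]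
    linarith [hre.2]
  have hd : 0 < (1 / 2 + lam).re := by
    have : (1 / 2 : ℂ).re = 1 / 2 := by norm_num
    rw [Complex.add_re, this]
    linarith [hre.1]
  set i : Fin n := ⟨0, by omega⟩
  have hsphere := isRadialEigenfunction_sphere_average hsupp hinv i (-lam - ((n : ℂ) - 1) / 2)
  have heuler := isRadialEigenfunction_euler (m := n - 1) (p := -lam - ((n : ℂ) - 1) / 2)
    (by push_cast; ring) (by push_cast; ring) hb hd
  push_cast at heuler
  have habs : ∫ v, ((Real.cosh s - Real.sinh s * v i : ℝ) : ℂ) ^ (-lam - ((n : ℂ) - 1) / 2) ∂σ =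
      ∫ v, ((Real.cosh |s| - Real.sinh |s| * v i : ℝ) : ℂ) ^ (-lam - ((n : ℂ) - 1) / 2) ∂σ := by
    rcases abs_choice s with h | h
    · rw [h]
    · rw [h, ← integral_comp_isometry hinv (LinearIsometryEquiv.neg ℝ)]
      simp
  rw [habs, hsphere.eq hn1 heuler (abs_nonneg s), Flam]
  have hsum : ((n : ℂ) - 1) / 2 - lam + (1 / 2 + lam) = n / 2 := by ring
  rw [hsum]
  congr 1
  refine intervalIntegral.integral_congr fun t _ => ?_
  simp only [← Complex.ofReal_cosh, Real.cosh_abs]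
  congr 2
  · congr 1
    ring
  · ring
  · ring
end

section
/- Let n ≥ 2, ρ = (n−1)/2, and let λ be either purely imaginary with nonnegative imaginary part or real with 0 < λ < ρ. The function F_λ satisfies the Gauss hypergeometric differential equation on ℂ∖[1,∞): for every z ∈ ℂ∖[1,∞), z(1−z)·F_λ''(z) + (n/2 − (2ρ+1)z)·F_λ'(z) − (ρ² − λ²)·F_λ(z) = 0, where F_λ' and F_λ'' denote the first and second complex derivatives. -/
open scoped BigOperators
open Filter Topology

lemma isOpen_compl_slit : IsOpen slitᶜ := by
  have h : IsClosed slit :=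
    (isClosed_eq Complex.continuous_im continuous_const).inter
      (isClosed_le continuous_const Complex.continuous_re)
  exact h.isOpen_compl

lemma one_sub_mul_ofReal_mem_slitPlane {z : ℂ} (hz : z ∈ slitᶜ) {t : ℝ}
    (ht : t ∈ Set.Icc (0 : ℝ) 1) : 1 - z * (t : ℂ) ∈ Complex.slitPlane := by
  rw [Complex.mem_slitPlane_iff]
  have hz' : z.im = 0 → z.re < 1 := fun h => not_le.1 fun h' => hz ⟨h, h'⟩
  have him : (1 - z * (t : ℂ)).im = -(z.im * t) := by simp
  have hre : (1 - z * (t : ℂ)).re = 1 - z.re * t := by simp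
  rw [him, hre]
  rcases ht.1.eq_or_lt with h0 | h0
  · left; simp [← h0]
  by_cases h : z.im = 0
  · left
    nlinarith [hz' h, ht.2]
  · right
    exact neg_ne_zero.2 (mul_ne_zero h h0.ne')

lemma continuousOn_one_sub_mul_cpow (s : ℂ) :
    ContinuousOn (fun p : ℂ × ℝ => (1 - p.1 * (p.2 : ℂ)) ^ s)
      (slitᶜ ×ˢ Set.Icc (0 : ℝ) 1) := by
  apply ContinuousOn.cpow (by fun_prop) (by fun_prop)
  rintro ⟨w, t⟩ ⟨hw, ht⟩
  exact one_sub_mul_ofReal_mem_slitPlane hw ht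

lemma continuousOn_one_sub_mul_cpow_right (s : ℂ) {z : ℂ} (hz : z ∈ slitᶜ) :
    ContinuousOn (fun t : ℝ => (1 - z * (t : ℂ)) ^ s) (Set.Icc (0 : ℝ) 1) := by
  apply ContinuousOn.cpow (by fun_prop) (by fun_prop)
  intro t ht
  exact one_sub_mul_ofReal_mem_slitPlane hz ht

lemma cpow_add_one_of_ne_zero {x : ℂ} (s : ℂ) (hx : x ≠ 0) : x ^ (s + 1) = x ^ s * x := by
  rw [Complex.cpow_add _ _ hx, Complex.cpow_one]

/-- The integrand of Euler's integral, with parameters `u`, `v`, `s`. -/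
noncomputable def eulerKernel (u v s z : ℂ) (t : ℝ) : ℂ :=
  (t : ℂ) ^ (u - 1) * (1 - (t : ℂ)) ^ (v - 1) * (1 - z * (t : ℂ)) ^ s

/-- Euler's integral `∫₀¹ t^(u-1) (1-t)^(v-1) (1-zt)^s dt`. -/
noncomputable def eulerIntegral (u v s z : ℂ) : ℂ :=
  ∫ t in (0 : ℝ)..1, eulerKernel u v s z t

lemma intervalIntegrable_eulerKernel {u v : ℂ} (hu : 0 < u.re) (hv : 0 < v.re) (s : ℂ) {z : ℂ}
    (hz : z ∈ slitᶜ) :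
    IntervalIntegrable (eulerKernel u v s z) MeasureTheory.volume 0 1 := by
  refine (Complex.betaIntegral_convergent hu hv).mul_continuousOn ?_
  rw [Set.uIcc_of_le zero_le_one]
  exact continuousOn_one_sub_mul_cpow_right s hz

lemma hasDerivAt_eulerIntegral {u v : ℂ} (hu : 0 < u.re) (hv : 0 < v.re) (s : ℂ) {z : ℂ}
    (hz : z ∈ slitᶜ) :
    HasDerivAt (eulerIntegral u v s) (-s * eulerIntegral (u + 1) v (s - 1) z) z := by
  obtain ⟨r, hr, hrs⟩ := Metric.nhds_basis_closedBall.mem_iff.1 (isOpen_compl_slit.mem_nhds hz)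
  obtain ⟨C, hC⟩ := ((isCompact_closedBall z r).prod
    (isCompact_Icc (a := (0 : ℝ)) (b := 1))).exists_bound_of_continuousOn
    ((continuousOn_one_sub_mul_cpow (s - 1)).mono (Set.prod_mono hrs subset_rfl))
  have hu' : 0 < (u + 1).re := by simp only [Complex.add_re, Complex.one_re]; linarith
  have hmeas : ∀ {u : ℂ} (s : ℂ), 0 < u.re → ∀ w ∈ slitᶜ,
      MeasureTheory.AEStronglyMeasurable (eulerKernel u v s w)
        (MeasureTheory.volume.restrict (Set.uIoc (0 : ℝ) 1)) := fun s hu w hw =>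
    (intervalIntegrable_eulerKernel hu hv s hw).def'.aestronglyMeasurable
  have key := intervalIntegral.hasDerivAt_integral_of_dominated_loc_of_deriv_le
    (μ := MeasureTheory.volume) (a := 0) (b := 1)
    (F := eulerKernel u v s) (F' := fun w t => -s * eulerKernel (u + 1) v (s - 1) w t)
    (bound := fun t : ℝ =>
      ‖s‖ * (‖(t : ℂ) ^ (u + 1 - 1) * (1 - (t : ℂ)) ^ (v - 1)‖ * C))
    (Metric.closedBall_mem_nhds z hr)
    ((isOpen_compl_slit.eventually_mem hz).mono (hmeas s hu))
    (intervalIntegrable_eulerKernel hu hv s hz)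
    ((hmeas (s - 1) hu' z hz).const_mul _)
    (Eventually.of_forall fun t ht w hw => by
      rw [Set.uIoc_of_le zero_le_one] at ht
      rw [norm_mul, norm_neg, eulerKernel, norm_mul]
      gcongr
      exact hC (w, t) ⟨hw, Set.Ioc_subset_Icc_self ht⟩)
    (((Complex.betaIntegral_convergent hu' hv).norm.mul_const C).const_mul ‖s‖)
    (Eventually.of_forall fun t ht w hw => by
      rw [Set.uIoc_of_le zero_le_one] at ht
      have ht0 : (t : ℂ) ≠ 0 := Complex.ofReal_ne_zero.2 ht.1.ne'
      have hbase : HasDerivAt (fun x : ℂ => 1 - x * (t : ℂ)) (-(t : ℂ)) w := by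
        simpa using ((hasDerivAt_id w).mul_const (t : ℂ)).const_sub 1
      have h := (hbase.cpow_const (c := s) (one_sub_mul_ofReal_mem_slitPlane (hrs hw)
        (Set.Ioc_subset_Icc_self ht))).const_mul ((t : ℂ) ^ (u - 1) * (1 - (t : ℂ)) ^ (v - 1))
      refine h.congr_deriv ?_
      rw [eulerKernel, show u + 1 - 1 = u - 1 + 1 by ring, cpow_add_one_of_ne_zero _ ht0]
      ring)
  have h := key.2
  rw [intervalIntegral.integral_const_mul] at h
  exact h

lemma eulerIntegral_hypergeometric_relation (a : ℂ) {b v : ℂ} (hb : 0 < b.re) (hv : 0 < v.re)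
    {z : ℂ} (hz : z ∈ slitᶜ) :
    z * (1 - z) * (a + 1) * eulerIntegral (b + 2) v (-a - 2) z +
      (b + v - (a + b + 1) * z) * eulerIntegral (b + 1) v (-a - 1) z -
      b * eulerIntegral b v (-a) z = 0 := by
  have hb1 : 0 < (b + 1).re := by simp only [Complex.add_re, Complex.one_re]; linarith
  have hb2 : 0 < (b + 2).re := by simp only [Complex.add_re, Complex.re_ofNat]; linarith
  have hb0 : b ≠ 0 := by rintro rfl; simp at hb
  have hv0 : v ≠ 0 := by rintro rfl; simp at hv
  have i0 := (intervalIntegrable_eulerKernel hb hv (-a) hz).const_mul b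
  have i1 := (intervalIntegrable_eulerKernel hb1 hv (-a - 1) hz).const_mul
    (b + v - (a + b + 1) * z)
  have i2 := (intervalIntegrable_eulerKernel hb2 hv (-a - 2) hz).const_mul
    (z * (1 - z) * (a + 1))
  have hcont : ContinuousOn (fun t : ℝ =>
      -((t : ℂ) ^ b * (1 - (t : ℂ)) ^ v * (1 - z * (t : ℂ)) ^ (-a - 1))) (Set.Icc 0 1) := by
    have h1 : Continuous fun t : ℝ => (1 - (t : ℂ)) ^ v := by
      have := (Complex.continuous_ofReal_cpow_const hv).comp (continuous_const.sub continuous_id :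
        Continuous fun t : ℝ => 1 - t)
      simpa [Function.comp_def] using this
    exact (((Complex.continuous_ofReal_cpow_const hb).mul h1).continuousOn.mul
      (continuousOn_one_sub_mul_cpow_right _ hz)).neg
  have ftc := intervalIntegral.integral_eq_sub_of_hasDerivAt_of_le zero_le_one hcont
    (fun t ht => ?_) ((i2.add i1).sub i0)
  · rw [intervalIntegral.integral_sub (i2.add i1) i0, intervalIntegral.integral_add i2 i1,
      intervalIntegral.integral_const_mul, intervalIntegral.integral_const_mul,
      intervalIntegral.integral_const_mul] at ftc
    simpa [eulerIntegral, Complex.zero_cpow hb0, Complex.zero_cpow hv0] using ftc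
  · have ht0 : (t : ℂ) ≠ 0 := Complex.ofReal_ne_zero.2 ht.1.ne'
    have ht1 : 1 - (t : ℂ) ≠ 0 := by
      rw [sub_ne_zero]; exact_mod_cast ht.2.ne'
    have hmem := one_sub_mul_ofReal_mem_slitPlane hz (Set.Ioo_subset_Icc_self ht)
    have hzt : 1 - z * (t : ℂ) ≠ 0 := Complex.slitPlane_ne_zero hmem
    have hmem1 : 1 - (t : ℂ) ∈ Complex.slitPlane := by
      rw [Complex.mem_slitPlane_iff]; left; simpa using ht.2
    have hid : HasDerivAt (fun x : ℂ => x) 1 (t : ℂ) := hasDerivAt_id _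
    have d1 := hid.cpow_const (c := b) (Complex.ofReal_mem_slitPlane.2 ht.1)
    have d2 := (hid.const_sub 1).cpow_const (c := v) hmem1
    have d3 := ((hid.const_mul z).const_sub 1).cpow_const (c := -a - 1) hmem
    refine (((d1.mul d2).mul d3).neg.comp_ofReal).congr_deriv ?_
    have e1 : (t : ℂ) ^ b = t ^ (b - 1) * t := by
      rw [← cpow_add_one_of_ne_zero _ ht0, sub_add_cancel]
    have e2 : (1 - (t : ℂ)) ^ v = (1 - (t : ℂ)) ^ (v - 1) * (1 - t) := by
      rw [← cpow_add_one_of_ne_zero _ ht1, sub_add_cancel]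
    have e3 : (1 - z * (t : ℂ)) ^ (-a - 1) = (1 - z * (t : ℂ)) ^ (-a - 2) * (1 - z * t) := by
      rw [← cpow_add_one_of_ne_zero _ hzt]; congr 1; ring
    have e4 : (1 - z * (t : ℂ)) ^ (-a) =
        (1 - z * (t : ℂ)) ^ (-a - 2) * (1 - z * t) * (1 - z * t) := by
      rw [← e3, ← cpow_add_one_of_ne_zero _ hzt]; congr 1; ring
    have e5 : (t : ℂ) ^ (b + 2 - 1) = t ^ (b - 1) * t * t := by
      rw [← e1, ← cpow_add_one_of_ne_zero _ ht0]; congr 1; ring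
    simp only [eulerKernel, Pi.mul_apply]
    rw [e5, e4, show b + 1 - 1 = b by ring, show -a - 1 - 1 = -a - 2 by ring, e1, e2, e3]
    ring

/-- Euler's integral solves the Gauss hypergeometric equation off the cut. -/
lemma eulerIntegral_hypergeometric_equation (a : ℂ) {b v : ℂ} (hb : 0 < b.re) (hv : 0 < v.re)
    {z : ℂ} (hz : z ∈ slitᶜ) :
    z * (1 - z) * deriv (deriv (eulerIntegral b v (-a))) z +
      (b + v - (a + b + 1) * z) * deriv (eulerIntegral b v (-a)) z -
      a * b * eulerIntegral b v (-a) z = 0 := by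
  have hb1 : 0 < (b + 1).re := by simp only [Complex.add_re, Complex.one_re]; linarith
  have h1 : deriv (eulerIntegral b v (-a)) =ᶠ[𝓝 z]
      fun w => a * eulerIntegral (b + 1) v (-a - 1) w := by
    filter_upwards [isOpen_compl_slit.mem_nhds hz] with w hw
    rw [(hasDerivAt_eulerIntegral hb hv (-a) hw).deriv, neg_neg]
  rw [h1.deriv_eq, h1.self_of_nhds,
    ((hasDerivAt_eulerIntegral hb1 hv (-a - 1) hz).const_mul a).deriv,
    show b + 1 + 1 = b + 2 by ring, show -a - 1 - 1 = -a - 2 by ring]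
  linear_combination a * eulerIntegral_hypergeometric_relation a hb hv hz

lemma admissible.re_sub_pos {n : ℕ} (hn : 2 ≤ n) {lam : ℂ} (h : admissible n lam) :
    0 < (((n : ℂ) - 1) / 2 - lam).re := by
  have hre : (((n : ℂ) - 1) / 2 - lam).re = ((n : ℝ) - 1) / 2 - lam.re := by
    simp
  have hn' : (2 : ℝ) ≤ n := by exact_mod_cast hn
  rw [hre]
  rcases h with ⟨h, -⟩ | ⟨-, -, h⟩ <;> linarith

lemma admissible.re_nonneg {n : ℕ} {lam : ℂ} (h : admissible n lam) : 0 ≤ lam.re := by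
  rcases h with ⟨h, -⟩ | ⟨-, h, -⟩ <;> linarith

theorem stmt10 (n : ℕ) (hn : 2 ≤ n) (lam : ℂ) (hlam : admissible n lam) :
    ∀ z ∈ slitᶜ,
      z * (1 - z) * deriv (deriv (Flam n lam)) z +
        ((n : ℂ)/2 - (2 * (((n : ℂ) - 1)/2) + 1) * z) * deriv (Flam n lam) z -
        ((((n : ℂ) - 1)/2)^2 - lam^2) * Flam n lam z = 0 := by
  intro z hz
  obtain ⟨c, hc⟩ : ∃ c : ℂ, Flam n lam = fun z => c *
      eulerIntegral (((n : ℂ) - 1)/2 - lam) (1/2 + lam) (-(((n : ℂ) - 1)/2 + lam)) z := by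
    refine ⟨Complex.Gamma ((n : ℂ)/2) /
      (Complex.Gamma (((n : ℂ) - 1)/2 - lam) * Complex.Gamma (1/2 + lam)), ?_⟩
    funext z
    rw [Flam, eulerIntegral]
    simp only [eulerKernel, neg_add', show (1 / 2 + lam - 1 : ℂ) = lam - 1 / 2 by ring]
  have hv : 0 < (1 / 2 + lam : ℂ).re := by
    have := hlam.re_nonneg
    simp only [Complex.add_re, Complex.div_ofNat_re, Complex.one_re]
    linarith
  rw [hc]
  simp only [deriv_const_mul_field']
  linear_combination c * eulerIntegral_hypergeometric_equation (((n : ℂ) - 1)/2 + lam)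
    (hlam.re_sub_pos hn) hv hz
end
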